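/- Assume Setup (†). Then for all sufficiently large n, the set L is empty and e(G[V_i]) ≤ a for each i ∈ [r]. -/

import Mathlib

open SimpleGraph

/-- The adjacency matrix of a simple graph over `ℝ`. -/
noncomputable def adjMat {V : Type*} [Fintype V] (G : SimpleGraph V) : Matrix V V ℝ :=
  letI := Classical.decRel G.Adj
  G.adjMatrix ℝ

/-- The spectral radius of a simple graph: the largest eigenvalue of its adjacency matrix. -/
noncomputable def specRad {V : Type*} [Fintype V] [DecidableEq V] (G : SimpleGraph V) : ℝ :=
  sSup (spectrum ℝ (adjMat G))

/-- The number of edges of a simple graph. -/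
noncomputable def eCnt {V : Type*} (G : SimpleGraph V) : ℕ := Nat.card G.edgeSet

/-- `G` contains a copy of `F` (a subgraph isomorphic to `F`). -/
def Contains {W V : Type*} (F : SimpleGraph W) (G : SimpleGraph V) : Prop :=
  ∃ f : F →g G, Function.Injective f

/-- `G` is `F`-free. -/
def FFree {W V : Type*} (F : SimpleGraph W) (G : SimpleGraph V) : Prop := ¬ Contains F G

/-- The Turán number `ex(n, F)`. -/
noncomputable def exNum {W : Type*} (n : ℕ) (F : SimpleGraph W) : ℕ :=
  sSup {m | ∃ G : SimpleGraph (Fin n), FFree F G ∧ eCnt G = m}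

/-- `G` is obtained from the Turán graph `T_{n,r}` by adding `a` edges. -/
def TuranPlus (n r a : ℕ) (G : SimpleGraph (Fin n)) : Prop :=
  (∃ H : SimpleGraph (Fin n), H ≤ G ∧ Nonempty (H ≃g turanGraph n r)) ∧
    eCnt G = eCnt (turanGraph n r) + a

/-- Hypothesis (★): for all sufficiently large `m`, `ex(m,F) = e(T_{m,r}) + a` and every
extremal graph is obtained from `T_{m,r}` by adding `a` edges. -/
def HypStar {W : Type*} (r a : ℕ) (F : SimpleGraph W) : Prop :=
  ∃ m₀ : ℕ, ∀ m ≥ m₀,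
    exNum m F = eCnt (turanGraph m r) + a ∧
    ∀ G : SimpleGraph (Fin m), FFree F G → eCnt G = exNum m F → TuranPlus m r a G

/-- `G` is a spectral-extremal `F`-free graph on its vertex set. -/
def SpecExtremal {W : Type*} (F : SimpleGraph W) {n : ℕ} (G : SimpleGraph (Fin n)) : Prop :=
  FFree F G ∧ ∀ G' : SimpleGraph (Fin n), FFree F G' → specRad G' ≤ specRad G

/-- Number of edges of `G` joining two distinct parts of the partition `p`. -/
noncomputable def crossCnt {n r : ℕ} (G : SimpleGraph (Fin n)) (p : Fin n → Fin r) : ℕ :=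
  Nat.card {e : Sym2 (Fin n) // e ∈ G.edgeSet ∧ ¬ (Sym2.map p e).IsDiag}

/-- Number of edges of `G` inside part `i` of the partition `p`, i.e. `e(G[Vᵢ])`. -/
noncomputable def inCnt {n r : ℕ} (G : SimpleGraph (Fin n)) (p : Fin n → Fin r)
    (i : Fin r) : ℕ :=
  Nat.card {e : Sym2 (Fin n) // e ∈ G.edgeSet ∧ Sym2.map p e = Sym2.diag i}

/-- The size of part `i` of the partition `p`, i.e. `|Vᵢ|`. -/
noncomputable def partSize {n r : ℕ} (p : Fin n → Fin r) (i : Fin r) : ℕ :=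
  Nat.card {v : Fin n // p v = i}

/-- The degree of `v` in `G`. -/
noncomputable def deg {n : ℕ} (G : SimpleGraph (Fin n)) (v : Fin n) : ℕ :=
  Nat.card (G.neighborSet v)

/-- `d_{Vᵢ}(v)`, the number of neighbours of `v` in part `i` of the partition `p`. -/
noncomputable def degIn {n r : ℕ} (G : SimpleGraph (Fin n)) (p : Fin n → Fin r)
    (i : Fin r) (v : Fin n) : ℕ :=
  Nat.card {w : Fin n // G.Adj v w ∧ p w = i}

/-- The partition `p` into `r` parts maximizes the number of edges between distinct parts,
`∑ eᵢ(Vᵢ) ≤ ε n²`, and each part has size strictly between `(1/r − 3√ε)n` and `(1/r + 3√ε)n`. -/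
def GoodPartition (r : ℕ) {n : ℕ} (G : SimpleGraph (Fin n)) (ε : ℝ)
    (p : Fin n → Fin r) : Prop :=
  (∀ q : Fin n → Fin r, crossCnt G q ≤ crossCnt G p) ∧
  (∑ i : Fin r, (inCnt G p i : ℝ)) ≤ ε * n ^ 2 ∧
  ∀ i : Fin r, (1 / (r : ℝ) - 3 * Real.sqrt ε) * n < partSize p i ∧
    (partSize p i : ℝ) < (1 / (r : ℝ) + 3 * Real.sqrt ε) * n

/-- The set `L` of low-degree vertices. -/
def Lset (r : ℕ) {n : ℕ} (G : SimpleGraph (Fin n)) (ε : ℝ) : Set (Fin n) :=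
  {v | (deg G v : ℝ) ≤ (1 - 1 / (r : ℝ) - 3 * r * ε ^ ((1 : ℝ) / 3)) * n}

/-- The set `W` of vertices with many neighbours inside their own part. -/
def Wset {n r : ℕ} (G : SimpleGraph (Fin n)) (p : Fin n → Fin r) (θ : ℝ) : Set (Fin n) :=
  {v | 2 * θ * n ≤ (degIn G p (p v) v : ℝ)}


/-! ### Spectral radius and the quadratic form of the adjacency matrix -/

open Classical in
theorem adjMat_apply {V : Type*} [Fintype V] (G : SimpleGraph V) (u v : V) :
    adjMat G u v = if G.Adj u v then 1 else 0 := by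
  simp only [adjMat, SimpleGraph.adjMatrix_apply]

theorem adjMat_nonneg {V : Type*} [Fintype V] (G : SimpleGraph V) (u v : V) :
    0 ≤ adjMat G u v := by
  rw [adjMat_apply]; split_ifs <;> norm_num

theorem adjMat_le_one {V : Type*} [Fintype V] (G : SimpleGraph V) (u v : V) :
    adjMat G u v ≤ 1 := by
  rw [adjMat_apply]; split_ifs <;> norm_num

theorem adjMat_isHermitian {V : Type*} [Fintype V] (G : SimpleGraph V) :
    (adjMat G).IsHermitian := by
  ext u v
  rw [Matrix.conjTranspose_apply, star_trivial, adjMat_apply, adjMat_apply]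
  by_cases h : G.Adj u v <;> simp [G.adj_comm v u, h]

theorem posSemidef_specRad_sub {n : ℕ} (G : SimpleGraph (Fin n)) :
    (algebraMap ℝ (Matrix (Fin n) (Fin n) ℝ) (specRad G) - adjMat G).PosSemidef := by
  rw [Matrix.posSemidef_iff_isHermitian_and_spectrum_nonneg]
  constructor
  · refine Matrix.IsHermitian.sub ?_ (adjMat_isHermitian G)
    rw [Algebra.algebraMap_eq_smul_one]
    ext u v
    simp [Matrix.conjTranspose_apply, Matrix.one_apply, eq_comm]
  · rw [← spectrum.singleton_sub_eq]
    rintro _ ⟨s, hs, t, ht, rfl⟩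
    rw [Set.mem_singleton_iff] at hs
    subst hs
    have := le_csSup (Matrix.finite_real_spectrum (A := adjMat G)).bddAbove ht
    simpa [specRad] using this

theorem dotProduct_specRad_sub {n : ℕ} (G : SimpleGraph (Fin n)) (c : ℝ) (y : Fin n → ℝ) :
    star y ⬝ᵥ (algebraMap ℝ (Matrix (Fin n) (Fin n) ℝ) c - adjMat G).mulVec y =
      c * ∑ u, y u ^ 2 - ∑ u, ∑ v, adjMat G u v * (y u * y v) := by
  rw [Matrix.sub_mulVec, Algebra.algebraMap_eq_smul_one, Matrix.smul_mulVec, Matrix.one_mulVec,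
    dotProduct_sub]
  simp only [dotProduct, Matrix.mulVec, Finset.mul_sum, Pi.smul_apply, smul_eq_mul, star_trivial]
  congr 1
  · exact Finset.sum_congr rfl fun u _ => by ring
  · exact Finset.sum_congr rfl fun u _ => Finset.sum_congr rfl fun v _ => by ring

theorem quadForm_le_specRad {n : ℕ} (G : SimpleGraph (Fin n)) (y : Fin n → ℝ) :
    ∑ u, ∑ v, adjMat G u v * (y u * y v) ≤ specRad G * ∑ u, y u ^ 2 := by
  have h := (posSemidef_specRad_sub G).dotProduct_mulVec_nonneg y
  rw [dotProduct_specRad_sub] at h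
  linarith

/-- A vector attaining the maximum of the Rayleigh quotient is an eigenvector. -/
theorem eigenvector_of_quadForm_ge {n : ℕ} (G : SimpleGraph (Fin n)) (y : Fin n → ℝ)
    (hy : specRad G * ∑ u, y u ^ 2 ≤ ∑ u, ∑ v, adjMat G u v * (y u * y v)) (u : Fin n) :
    ∑ v, adjMat G u v * y v = specRad G * y u := by
  have h0 : star y ⬝ᵥ (algebraMap ℝ (Matrix (Fin n) (Fin n) ℝ) (specRad G) -
      adjMat G).mulVec y = 0 := by
    rw [dotProduct_specRad_sub]
    linarith [quadForm_le_specRad G y]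
  have h1 := congrFun (((posSemidef_specRad_sub G).dotProduct_mulVec_zero_iff y).1 h0) u
  rw [Matrix.sub_mulVec, Algebra.algebraMap_eq_smul_one, Matrix.smul_mulVec,
    Matrix.one_mulVec] at h1
  simp only [Pi.sub_apply, Pi.smul_apply, smul_eq_mul, Pi.zero_apply, Matrix.mulVec,
    dotProduct] at h1
  linarith

/-- A nonnegative eigenvector for the spectral radius, of squared norm `n`. -/
theorem exists_nonneg_eigenvector {n : ℕ} (hn : 0 < n) (G : SimpleGraph (Fin n)) :
    ∃ y : Fin n → ℝ, (∀ u, 0 ≤ y u) ∧ ∑ u, y u ^ 2 = n ∧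
      ∀ u, ∑ v, adjMat G u v * y v = specRad G * y u := by
  have : Nonempty (Fin n) := ⟨⟨0, hn⟩⟩
  have hmem : specRad G ∈ spectrum ℝ (adjMat G) := by
    refine Set.Nonempty.csSup_mem ?_ Matrix.finite_real_spectrum
    rw [(adjMat_isHermitian G).spectrum_real_eq_range_eigenvalues]
    exact Set.range_nonempty _
  rw [spectrum.mem_iff, Matrix.isUnit_iff_isUnit_det, isUnit_iff_ne_zero, not_not,
    ← Matrix.exists_mulVec_eq_zero_iff] at hmem
  obtain ⟨z, hz, hz0⟩ := hmem
  have hq := dotProduct_specRad_sub G (specRad G) z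
  rw [hz0, dotProduct_zero] at hq
  have hpos : 0 < ∑ u, z u ^ 2 := by
    obtain ⟨u, hu⟩ := Function.ne_iff.1 hz
    exact Finset.sum_pos' (fun _ _ => sq_nonneg _) ⟨u, Finset.mem_univ _, (sq_pos_iff.2 hu)⟩
  set c : ℝ := Real.sqrt (n / ∑ u, z u ^ 2) with hc
  have hc0 : 0 ≤ c := Real.sqrt_nonneg _
  have hcsq : c ^ 2 * ∑ u, z u ^ 2 = n := by
    rw [hc, Real.sq_sqrt (by positivity)]
    field_simp
  have hsq : ∑ u, (c * |z u|) ^ 2 = n := by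
    rw [← hcsq, Finset.mul_sum]
    exact Finset.sum_congr rfl fun u _ => by rw [mul_pow, sq_abs]
  refine ⟨fun u => c * |z u|, fun u => by positivity, hsq, eigenvector_of_quadForm_ge G _ ?_⟩
  rw [hsq, ← hcsq]
  calc specRad G * (c ^ 2 * ∑ u, z u ^ 2)
      = c ^ 2 * ∑ u, ∑ v, adjMat G u v * (z u * z v) := by linear_combination (-c ^ 2) * hq
    _ ≤ ∑ u, ∑ v, adjMat G u v * (c * |z u| * (c * |z v|)) := by
        simp only [Finset.mul_sum]
        refine Finset.sum_le_sum fun u _ => Finset.sum_le_sum fun v _ => ?_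
        have h1 : z u * z v ≤ |z u| * |z v| := by rw [← abs_mul]; exact le_abs_self _
        have h2 := mul_le_mul_of_nonneg_left h1 (mul_nonneg (sq_nonneg c) (adjMat_nonneg G u v))
        linarith

theorem quadForm_of_eigenvector {n : ℕ} (G : SimpleGraph (Fin n)) {y : Fin n → ℝ}
    (hy : ∀ u, ∑ v, adjMat G u v * y v = specRad G * y u) :
    ∑ u, ∑ v, adjMat G u v * (y u * y v) = specRad G * ∑ u, y u ^ 2 := by
  rw [Finset.mul_sum]
  refine Finset.sum_congr rfl fun u _ => ?_
  calc ∑ v, adjMat G u v * (y u * y v) = y u * ∑ v, adjMat G u v * y v := by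
        rw [Finset.mul_sum]; exact Finset.sum_congr rfl fun v _ => by ring
    _ = specRad G * y u ^ 2 := by rw [hy u]; ring

/-! ### Counting edges and non-edges -/

open Classical in
theorem two_mul_card_edges_eq_sum {n : ℕ} (G : SimpleGraph (Fin n)) (P : Sym2 (Fin n) → Prop) :
    2 * Nat.card {e : Sym2 (Fin n) // e ∈ G.edgeSet ∧ P e} =
      ∑ u, ∑ w, if G.Adj u w ∧ P s(u, w) then 1 else 0 := by
  let H : SimpleGraph (Fin n) :=
    { Adj := fun u w => G.Adj u w ∧ P s(u, w)
      symm := ⟨fun u w h => ⟨h.1.symm, by rw [Sym2.eq_swap]; exact h.2⟩⟩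
      loopless := ⟨fun u h => G.loopless.irrefl u h.1⟩ }
  have hE : {e : Sym2 (Fin n) | e ∈ G.edgeSet ∧ P e} = H.edgeSet := by
    ext e
    induction e with
    | h u w => rfl
  have h1 : Nat.card {e : Sym2 (Fin n) // e ∈ G.edgeSet ∧ P e} = H.edgeFinset.card := by
    rw [SimpleGraph.edgeFinset_card, ← Nat.card_eq_fintype_card]
    exact congrArg (fun s : Set (Sym2 (Fin n)) => Nat.card s) hE
  rw [h1, ← H.sum_degrees_eq_twice_card_edges]
  refine Finset.sum_congr rfl fun u _ => ?_
  rw [← SimpleGraph.card_neighborFinset_eq_degree, SimpleGraph.neighborFinset_eq_filter,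
    Finset.card_filter]

theorem two_mul_crossCnt {n r : ℕ} (G : SimpleGraph (Fin n)) (p : Fin n → Fin r) :
    (2 * crossCnt G p : ℝ) = ∑ u, ∑ w, adjMat G u w * if p u = p w then 0 else 1 := by
  classical
  have h := two_mul_card_edges_eq_sum G (fun e => ¬ (Sym2.map p e).IsDiag)
  have h2 := congrArg (Nat.cast : ℕ → ℝ) h
  push_cast at h2
  rw [crossCnt, h2]
  refine Finset.sum_congr rfl fun u _ => Finset.sum_congr rfl fun w _ => ?_
  rw [adjMat_apply]
  by_cases h1 : G.Adj u w <;> by_cases h2 : p u = p w <;> simp [h1, h2]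

theorem two_mul_sum_inCnt {n r : ℕ} (G : SimpleGraph (Fin n)) (p : Fin n → Fin r) :
    2 * ∑ i, (inCnt G p i : ℝ) = ∑ u, ∑ w, adjMat G u w * if p u = p w then 1 else 0 := by
  classical
  have h (i : Fin r) : (2 * inCnt G p i : ℝ) =
      ∑ u, ∑ w, adjMat G u w * if p u = i ∧ p w = i then 1 else 0 := by
    have h := two_mul_card_edges_eq_sum G (fun e => Sym2.map p e = Sym2.diag i)
    have h2 := congrArg (Nat.cast : ℕ → ℝ) h
    push_cast at h2
    rw [inCnt, h2]
    refine Finset.sum_congr rfl fun u _ => Finset.sum_congr rfl fun w _ => ?_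
    rw [adjMat_apply]
    by_cases h1 : G.Adj u w <;> simp [h1, Sym2.diag]
  rw [Finset.mul_sum, Finset.sum_congr rfl fun i _ => h i, Finset.sum_comm]
  refine Finset.sum_congr rfl fun u _ => ?_
  rw [Finset.sum_comm]
  refine Finset.sum_congr rfl fun w _ => ?_
  rw [← Finset.mul_sum]
  congr 1
  by_cases hp : p u = p w
  · simp [hp]
  · rw [if_neg hp]
    refine Finset.sum_eq_zero fun i _ => if_neg fun hi => hp (hi.1.trans hi.2.symm)

theorem degIn_eq_sum {n r : ℕ} (G : SimpleGraph (Fin n)) (p : Fin n → Fin r) (i : Fin r)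
    (v : Fin n) : (degIn G p i v : ℝ) = ∑ w, adjMat G v w * if p w = i then 1 else 0 := by
  classical
  rw [degIn, Nat.card_eq_fintype_card, Fintype.card_subtype, Finset.card_filter]
  push_cast
  refine Finset.sum_congr rfl fun w _ => ?_
  rw [adjMat_apply]
  by_cases h1 : G.Adj v w <;> simp [h1]

theorem deg_eq_sum {n : ℕ} (G : SimpleGraph (Fin n)) (v : Fin n) :
    (deg G v : ℝ) = ∑ w, adjMat G v w := by
  classical
  rw [deg, Nat.card_eq_fintype_card, SimpleGraph.card_neighborSet_eq_degree,
    ← SimpleGraph.card_neighborFinset_eq_degree, SimpleGraph.neighborFinset_eq_filter,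
    Finset.card_filter]
  push_cast
  exact Finset.sum_congr rfl fun w _ => (adjMat_apply G v w).symm

theorem partSize_eq_card {n r : ℕ} (p : Fin n → Fin r) (i : Fin r) :
    partSize p i = (Finset.univ.filter fun v => p v = i).card := by
  rw [partSize, Nat.card_eq_fintype_card, Fintype.card_subtype]

theorem adjMat_symm {V : Type*} [Fintype V] (G : SimpleGraph V) (u v : V) :
    adjMat G u v = adjMat G v u := by
  simpa using (adjMat_isHermitian G).apply v u

theorem sum_sum_eq_two_mul_add {V : Type*} [Fintype V] [DecidableEq V] {f : V → V → ℝ} {v : V}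
    (hself : f v v = 0) (hsymm : ∀ u w, f u w = f w u) :
    ∑ u, ∑ w, f u w =
      2 * ∑ w, f v w + ∑ u ∈ Finset.univ.erase v, ∑ w ∈ Finset.univ.erase v, f u w := by
  have hcol : ∑ u ∈ Finset.univ.erase v, f u v = ∑ w, f v w := by
    rw [← Finset.add_sum_erase _ _ (Finset.mem_univ v), hself, zero_add]
    exact Finset.sum_congr rfl fun w _ => hsymm w v
  rw [← Finset.add_sum_erase _ _ (Finset.mem_univ v),
    Finset.sum_congr rfl fun u _ => (Finset.add_sum_erase _ _ (Finset.mem_univ v)).symm,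
    Finset.sum_add_distrib, hcol]
  ring

/-- In a partition maximizing the number of crossing edges, no vertex has fewer neighbours in
another part than in its own. -/
theorem degIn_le_of_crossCnt_max {n r : ℕ} {G : SimpleGraph (Fin n)} {p : Fin n → Fin r}
    (hp : ∀ q : Fin n → Fin r, crossCnt G q ≤ crossCnt G p) (v : Fin n) (j : Fin r) :
    degIn G p (p v) v ≤ degIn G p j v := by
  classical
  by_cases hj : j = p v
  · rw [hj]
  have key (q : Fin n → Fin r) : (2 * crossCnt G q : ℝ) =
      2 * (∑ w, adjMat G v w - degIn G q (q v) v) +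
        ∑ u ∈ Finset.univ.erase v, ∑ w ∈ Finset.univ.erase v,
          adjMat G u w * if q u = q w then 0 else 1 := by
    have hrow : ∑ w, adjMat G v w * (if q v = q w then 0 else 1) =
        ∑ w, adjMat G v w - degIn G q (q v) v := by
      rw [degIn_eq_sum, ← Finset.sum_sub_distrib]
      refine Finset.sum_congr rfl fun w _ => ?_
      by_cases h : q v = q w
      · simp [h]
      · simp [h, Ne.symm h]
    rw [two_mul_crossCnt, sum_sum_eq_two_mul_add (v := v) (by simp)
      fun u w => by simp only [adjMat_symm G u w, eq_comm], hrow]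
  let q := Function.update p v j
  have hqv : q v = j := Function.update_self ..
  have hqu (u : Fin n) (hu : u ≠ v) : q u = p u := Function.update_of_ne hu ..
  have h1 := key p
  have h2 := key q
  have h3 : ∑ u ∈ Finset.univ.erase v, ∑ w ∈ Finset.univ.erase v,
      adjMat G u w * (if q u = q w then 0 else 1) =
      ∑ u ∈ Finset.univ.erase v, ∑ w ∈ Finset.univ.erase v,
        adjMat G u w * if p u = p w then 0 else 1 := by
    refine Finset.sum_congr rfl fun u hu => Finset.sum_congr rfl fun w hw => ?_
    rw [hqu u (Finset.ne_of_mem_erase hu), hqu w (Finset.ne_of_mem_erase hw)]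
  have h4 : degIn G q (q v) v = degIn G p j v := by
    rw [hqv]
    unfold degIn
    refine Nat.card_congr (Equiv.subtypeEquivRight fun w => ?_)
    refine and_congr_right fun hw => ?_
    rw [hqu w hw.ne']
  have h5 : (crossCnt G q : ℝ) ≤ crossCnt G p := by exact_mod_cast hp q
  rw [h4, h3] at h2
  have : (degIn G p (p v) v : ℝ) ≤ degIn G p j v := by linarith
  exact_mod_cast this

/-- The vertices outside the part of `v` which are not adjacent to `v`. -/
noncomputable def missing {n r : ℕ} (G : SimpleGraph (Fin n)) (p : Fin n → Fin r) (v : Fin n) :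
    Finset (Fin n) :=
  letI := Classical.decRel G.Adj
  Finset.univ.filter fun w => p v ≠ p w ∧ ¬ G.Adj v w

theorem mem_missing {n r : ℕ} {G : SimpleGraph (Fin n)} {p : Fin n → Fin r} {v w : Fin n} :
    w ∈ missing G p v ↔ p v ≠ p w ∧ ¬ G.Adj v w := by
  simp [missing]

theorem sum_missing {n r : ℕ} (G : SimpleGraph (Fin n)) (p : Fin n → Fin r) (v : Fin n)
    (f : Fin n → ℝ) :
    ∑ w ∈ missing G p v, f w = ∑ w, (1 - adjMat G v w) * (if p v = p w then 0 else 1) * f w := by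
  classical
  rw [missing, Finset.sum_filter]
  refine Finset.sum_congr rfl fun w _ => ?_
  rw [adjMat_apply]
  by_cases h1 : G.Adj v w <;> by_cases h2 : p v = p w <;> simp [h1, h2]

/-- The average degree of the Turán graph bounds its spectral radius from below. -/
theorem specRad_turanGraph_ge {n r : ℕ} (hn : 0 < n) :
    (1 - 1 / (r : ℝ)) * n - 1 ≤ specRad (turanGraph n r) := by
  classical
  have h := quadForm_le_specRad (turanGraph n r) (fun _ => 1)
  have hcard (u : Fin n) :
      ((Finset.univ.filter fun v : Fin n => (u : ℕ) % r = v % r).card : ℝ) ≤ n / r + 1 := by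
    have h1 : (Finset.univ.filter fun v : Fin n => (u : ℕ) % r = v % r).card ≤
        (Finset.range (n / r + 1)).card := by
      refine Finset.card_le_card_of_injOn (fun v => (v : ℕ) / r) ?_ ?_
      · intro v _
        simp only [Finset.coe_range, Set.mem_Iio]
        exact Nat.lt_succ_of_le (Nat.div_le_div_right v.2.le)
      · intro v hv w hw hvw
        simp only [Finset.coe_filter, Finset.mem_univ, true_and, Set.mem_ofPred_eq] at hv hw
        ext
        rw [← Nat.div_add_mod (v : ℕ) r, ← Nat.div_add_mod (w : ℕ) r, ← hv, ← hw]
        simp only at hvw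
        rw [hvw]
    rw [Finset.card_range] at h1
    calc ((Finset.univ.filter fun v : Fin n => (u : ℕ) % r = v % r).card : ℝ)
        ≤ ((n / r + 1 : ℕ) : ℝ) := by exact_mod_cast h1
      _ ≤ n / r + 1 := by push_cast; gcongr; exact Nat.cast_div_le
  have hrow (u : Fin n) : (n : ℝ) - (n / r + 1) ≤
      ∑ v, adjMat (turanGraph n r) u v * ((1 : ℝ) * 1) := by
    have h2 : ∑ v, adjMat (turanGraph n r) u v * ((1 : ℝ) * 1) =
        n - ((Finset.univ.filter fun v : Fin n => (u : ℕ) % r = v % r).card : ℝ) := by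
      rw [Finset.card_filter]
      push_cast
      have h3 : (n : ℝ) = ∑ _v : Fin n, (1 : ℝ) := by simp
      conv_rhs => rw [h3]
      rw [← Finset.sum_sub_distrib]
      refine Finset.sum_congr rfl fun v _ => ?_
      rw [adjMat_apply]
      by_cases h4 : (u : ℕ) % r = v % r <;> simp [turanGraph, h4]
    rw [h2]
    linarith [hcard u]
  have h6 := Finset.sum_le_sum fun u (_ : u ∈ Finset.univ) => hrow u
  have h7 := h6.trans h
  simp only [Finset.sum_const, Finset.card_univ, Fintype.card_fin, nsmul_eq_mul, one_pow,
    mul_one] at h7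
  have hn' : (0 : ℝ) < n := by exact_mod_cast hn
  rw [mul_comm] at h7
  have h8 := le_of_mul_le_mul_right h7 hn'
  calc (1 - 1 / (r : ℝ)) * n - 1 = n - (n / r + 1) := by ring
    _ ≤ _ := h8

/-! ### Stability of the eigenvector and of the partition -/

theorem sq_sum_le_mul_sum_same_part {n r : ℕ} (p : Fin n → Fin r) (y : Fin n → ℝ) :
    (∑ u, y u) ^ 2 ≤ r * ∑ u, ∑ w, (if p u = p w then 1 else 0) * (y u * y w) := by
  classical
  have h1 : ∑ u, ∑ w, (if p u = p w then 1 else 0) * (y u * y w) =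
      ∑ i, (∑ u, if p u = i then y u else 0) ^ 2 := by
    simp only [sq, Finset.sum_mul_sum]
    rw [Finset.sum_comm (s := (Finset.univ : Finset (Fin r)))]
    refine Finset.sum_congr rfl fun u _ => ?_
    rw [Finset.sum_comm (s := (Finset.univ : Finset (Fin r)))]
    refine Finset.sum_congr rfl fun w _ => ?_
    by_cases h : p u = p w <;> simp [h, eq_comm]
  have h2 : ∑ u, y u = ∑ i, ∑ u, if p u = i then y u else 0 := by
    rw [Finset.sum_comm]
    simp
  rw [h1, h2]
  simpa using sq_sum_le_card_mul_sum_sq (s := (Finset.univ : Finset (Fin r)))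
    (f := fun i => ∑ u, if p u = i then y u else 0)

/-- Two vertices whose entries are both close to `1` contribute substantially to the quadratic
form, so the number of missing pairs is controlled by their weight. -/
theorem sum_card_missing_le {n r : ℕ} (G : SimpleGraph (Fin n)) (p : Fin n → Fin r)
    {y : Fin n → ℝ} (hy0 : ∀ u, 0 ≤ y u) :
    ∑ u, ((missing G p u).card : ℝ) ≤
      4 * ∑ u, ∑ w ∈ missing G p u, y u * y w + 8 * n * ∑ u, (y u - 1) ^ 2 := by
  have hpt (u w : Fin n) : 1 ≤ 4 * (y u * y w) + 4 * (y u - 1) ^ 2 + 4 * (y w - 1) ^ 2 := by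
    have := hy0 u
    have := hy0 w
    by_cases h1 : y u < 1 / 2
    · nlinarith [mul_nonneg (hy0 u) (hy0 w), sq_nonneg (y w - 1)]
    · by_cases h2 : y w < 1 / 2
      · nlinarith [mul_nonneg (hy0 u) (hy0 w), sq_nonneg (y u - 1)]
      · nlinarith [sq_nonneg (y w - 1), sq_nonneg (y u - 1)]
  calc ∑ u, ((missing G p u).card : ℝ)
      = ∑ u, ∑ w ∈ missing G p u, (1 : ℝ) := by simp
    _ ≤ ∑ u, ∑ w ∈ missing G p u,
          (4 * (y u * y w) + (4 * (y u - 1) ^ 2 + 4 * (y w - 1) ^ 2)) := by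
        refine Finset.sum_le_sum fun u _ => Finset.sum_le_sum fun w _ => ?_
        linarith [hpt u w]
    _ = 4 * ∑ u, ∑ w ∈ missing G p u, y u * y w +
          ∑ u, ∑ w ∈ missing G p u, (4 * (y u - 1) ^ 2 + 4 * (y w - 1) ^ 2) := by
        simp only [Finset.sum_add_distrib, Finset.mul_sum]
    _ ≤ 4 * ∑ u, ∑ w ∈ missing G p u, y u * y w +
          ∑ u : Fin n, ∑ w : Fin n, (4 * (y u - 1) ^ 2 + 4 * (y w - 1) ^ 2) := by
        refine add_le_add le_rfl (Finset.sum_le_sum fun u _ => ?_)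
        exact Finset.sum_le_sum_of_subset_of_nonneg (Finset.subset_univ _)
          fun w _ _ => by positivity
    _ = 4 * ∑ u, ∑ w ∈ missing G p u, y u * y w + 8 * n * ∑ u, (y u - 1) ^ 2 := by
        simp only [Finset.sum_add_distrib, ← Finset.mul_sum, Finset.sum_const, Finset.card_univ,
          Fintype.card_fin, nsmul_eq_mul]
        ring

/-- If the spectral radius is almost that of the Turán graph and there are few edges inside the
parts, then the leading eigenvector is nearly constant and few crossing edges are missing. -/
theorem stability_of_specRad_ge {n r : ℕ} (hr : 2 ≤ r) (hn : 6 ≤ n) {G : SimpleGraph (Fin n)}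
    {p : Fin n → Fin r} {ε : ℝ} (hεn : 1 ≤ ε * n)
    (hlam : (1 - 1 / (r : ℝ)) * n - 1 ≤ specRad G)
    (hin : ∑ i, (inCnt G p i : ℝ) ≤ ε * n ^ 2) {y : Fin n → ℝ} (hy0 : ∀ u, 0 ≤ y u)
    (hyn : ∑ u, y u ^ 2 = n) (hy : ∀ u, ∑ v, adjMat G u v * y v = specRad G * y u) :
    ∑ u, (y u - 1) ^ 2 ≤ 76 * ε * n ∧
      ∑ u, ((missing G p u).card : ℝ) ≤ 684 * ε * n ^ 2 := by
  classical
  set s := ∑ u, y u with hs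
  have hr' : (2 : ℝ) ≤ r := by exact_mod_cast hr
  have hn' : (6 : ℝ) ≤ n := by exact_mod_cast hn
  have hrinv : 1 / (r : ℝ) ≤ 1 / 2 := one_div_le_one_div_of_le (by norm_num) hr'
  have hrinv0 : 0 < 1 / (r : ℝ) := by positivity
  have hs0 : 0 ≤ s := Finset.sum_nonneg fun u _ => hy0 u
  have hs2 : s ^ 2 ≤ (n : ℝ) ^ 2 := by
    have := sq_sum_le_card_mul_sum_sq (s := (Finset.univ : Finset (Fin n))) (f := y)
    rw [hyn, Finset.card_univ, Fintype.card_fin] at this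
    linarith [sq (n : ℝ)]
  have hsn : s ≤ n := abs_le_of_sq_le_sq' hs2 (by linarith) |>.2
  have hlam3 : (n : ℝ) / 3 ≤ specRad G := by nlinarith
  have hy3 (u : Fin n) : y u ≤ 3 := by
    have h1 : specRad G * y u ≤ s := by
      rw [← hy u]
      refine Finset.sum_le_sum fun v _ => ?_
      nlinarith [hy0 v, adjMat_le_one G u v]
    have h2 := hy0 u
    nlinarith
  have hquad := quadForm_of_eigenvector G hy
  rw [hyn] at hquad
  have hinner : ∑ u, ∑ w, adjMat G u w * (if p u = p w then 1 else 0) * (y u * y w) ≤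
      18 * ε * n ^ 2 := by
    calc ∑ u, ∑ w, adjMat G u w * (if p u = p w then 1 else 0) * (y u * y w)
        ≤ ∑ u, ∑ w, 9 * (adjMat G u w * (if p u = p w then 1 else 0)) := by
          refine Finset.sum_le_sum fun u _ => Finset.sum_le_sum fun w _ => ?_
          have h1 : y u * y w ≤ 9 := by
            nlinarith [hy0 u, hy0 w, hy3 u, hy3 w]
          have h2 : 0 ≤ adjMat G u w * (if p u = p w then (1 : ℝ) else 0) :=
            mul_nonneg (adjMat_nonneg G u w) (by split_ifs <;> norm_num)
          nlinarith
      _ = 9 * (2 * ∑ i, (inCnt G p i : ℝ)) := by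
          rw [two_mul_sum_inCnt]
          simp only [Finset.mul_sum]
      _ ≤ 18 * ε * n ^ 2 := by linarith
  have hpart := sq_sum_le_mul_sum_same_part p y
  rw [← hs] at hpart
  set same := ∑ u, ∑ w, (if p u = p w then (1 : ℝ) else 0) * (y u * y w) with hsame
  have hdecomp : ∑ u, ∑ w, adjMat G u w * (y u * y w) =
      ∑ u, ∑ w, adjMat G u w * (if p u = p w then 1 else 0) * (y u * y w) + (s ^ 2 - same) -
        ∑ u, ∑ w ∈ missing G p u, y u * y w := by
    rw [hsame, hs, sq, Finset.sum_mul_sum]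
    simp only [sum_missing, ← Finset.sum_sub_distrib, ← Finset.sum_add_distrib]
    refine Finset.sum_congr rfl fun u _ => Finset.sum_congr rfl fun w _ => ?_
    split_ifs <;> ring
  have hsame' : 1 / (r : ℝ) * s ^ 2 ≤ same := by
    rw [one_div, inv_mul_le_iff₀ (by linarith)]
    exact hpart
  have hmis0 : 0 ≤ ∑ u, ∑ w ∈ missing G p u, y u * y w :=
    Finset.sum_nonneg fun u _ => Finset.sum_nonneg fun w _ => mul_nonneg (hy0 u) (hy0 w)
  have hmain : ((1 - 1 / (r : ℝ)) * n - 1) * n ≤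
      18 * ε * n ^ 2 + (1 - 1 / (r : ℝ)) * s ^ 2 - ∑ u, ∑ w ∈ missing G p u, y u * y w := by
    have := mul_le_mul_of_nonneg_right hlam (by linarith : (0 : ℝ) ≤ n)
    linarith
  have hεn2 : (n : ℝ) ≤ ε * n ^ 2 := by nlinarith
  have hmis : ∑ u, ∑ w ∈ missing G p u, y u * y w ≤ 19 * ε * n ^ 2 := by nlinarith
  have hns : (n : ℝ) ^ 2 - s ^ 2 ≤ 38 * ε * n ^ 2 := by nlinarith
  have hns' : n - s ≤ 38 * ε * n := by
    have h1 : (n - s) * n ≤ 38 * ε * n * n := by nlinarith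
    exact le_of_mul_le_mul_right h1 (by linarith)
  have hdev : ∑ u, (y u - 1) ^ 2 ≤ 76 * ε * n := by
    have : ∑ u, (y u - 1) ^ 2 = n - 2 * s + n := by
      rw [hs, ← hyn, Finset.mul_sum]
      conv_rhs => rw [hyn]
      have h3 : (n : ℝ) = ∑ _v : Fin n, (1 : ℝ) := by simp
      conv_rhs => rw [← hyn, ← Finset.sum_sub_distrib]
      rw [hyn, h3, ← Finset.sum_add_distrib]
      exact Finset.sum_congr rfl fun u _ => by ring
    linarith
  refine ⟨hdev, ?_⟩
  nlinarith [sum_card_missing_le G p hy0]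

/-! ### Consequences of the Turán-type hypothesis -/

theorem eCnt_le_exNum {W : Type*} {F : SimpleGraph W} {m : ℕ} {H : SimpleGraph (Fin m)}
    (hH : FFree F H) : eCnt H ≤ exNum m F := by
  refine le_csSup ⟨Nat.card (Sym2 (Fin m)), ?_⟩ ⟨H, hH, rfl⟩
  rintro _ ⟨H', -, rfl⟩
  exact Nat.card_le_card_of_injective _ Subtype.val_injective

theorem Contains.trans {W V U : Type*} {F : SimpleGraph W} {H : SimpleGraph V}
    {G : SimpleGraph U} (h₁ : Contains F H) (h₂ : Contains H G) : Contains F G := by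
  obtain ⟨f, hf⟩ := h₁
  obtain ⟨g, hg⟩ := h₂
  exact ⟨g.comp f, hg.comp hf⟩

theorem turanGraph_fFree {W : Type*} {F : SimpleGraph W} {r a m : ℕ} (hr : 2 ≤ r) (hm : 2 ≤ m)
    (hex : exNum m F = eCnt (turanGraph m r) + a)
    (hext : ∀ G : SimpleGraph (Fin m), FFree F G → eCnt G = exNum m F → TuranPlus m r a G) :
    FFree F (turanGraph m r) := by
  have hpos : 0 < eCnt (turanGraph m r) := by
    have : Nonempty (turanGraph m r).edgeSet := by
      refine ⟨⟨s(⟨0, by omega⟩, ⟨1, by omega⟩), ?_⟩⟩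
      simp only [SimpleGraph.mem_edgeSet, turanGraph]
      rw [Nat.zero_mod, Nat.mod_eq_of_lt (by omega)]
      norm_num
    exact Nat.card_pos
  have hmem : exNum m F ∈ {k | ∃ G : SimpleGraph (Fin m), FFree F G ∧ eCnt G = k} := by
    refine Nat.sSup_mem ?_ ⟨Nat.card (Sym2 (Fin m)), ?_⟩
    · by_contra hne
      rw [Set.not_nonempty_iff_eq_empty] at hne
      rw [exNum, hne, csSup_empty, Nat.bot_eq_zero] at hex
      omega
    · rintro _ ⟨H', -, rfl⟩
      exact Nat.card_le_card_of_injective _ Subtype.val_injective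
  obtain ⟨G, hG, hGe⟩ := hmem
  obtain ⟨⟨H, hHG, ⟨φ⟩⟩, -⟩ := hext G hG hGe
  intro hc
  refine hG (hc.trans ⟨(SimpleGraph.Hom.ofLE hHG).comp φ.symm.toHom, ?_⟩)
  exact φ.symm.injective

/-- A copy of the Turán graph together with more than `a` additional edges forces a copy
of `F`. -/
theorem contains_of_turan_embedding {W V : Type*} {F : SimpleGraph W} {r a m : ℕ}
    (hex : exNum m F = eCnt (turanGraph m r) + a) {G : SimpleGraph V} {g : Fin m → V}
    (hg : Function.Injective g) (hT : ∀ i j : Fin m, (i : ℕ) % r ≠ j % r → G.Adj (g i) (g j))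
    (E : Finset (Sym2 (Fin m))) (hE : a < E.card)
    (hET : ∀ e ∈ E, e ∉ (turanGraph m r).edgeSet) (hEG : ∀ e ∈ E, Sym2.map g e ∈ G.edgeSet) :
    Contains F G := by
  have hHG : Contains (G.comap g) G := ⟨⟨g, fun h => h⟩, hg⟩
  refine Contains.trans ?_ hHG
  by_contra hc
  have h1 := eCnt_le_exNum hc
  have hsub : (turanGraph m r).edgeSet ∪ E ⊆ (G.comap g).edgeSet := by
    rintro e (he | he)
    · induction e with
      | h u w => exact hT u w he
    · have := hEG e he
      induction e with
      | h u w => exact this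
  have hdis : Disjoint (turanGraph m r).edgeSet (E : Set (Sym2 (Fin m))) :=
    Set.disjoint_right.2 fun e he => hET e he
  have h2 := Set.ncard_le_ncard hsub (Set.toFinite _)
  rw [Set.ncard_union_eq hdis (Set.toFinite _) (Set.toFinite _), Set.ncard_coe_finset] at h2
  simp only [Set.ncard_def, Set.encard] at h2
  have h3 : eCnt (turanGraph m r) + E.card ≤ eCnt (G.comap g) := h2
  omega

/-- A family of vertices chosen greedily: the vertices indexed by `T₀` are prescribed, and each
further vertex is chosen from a candidate set in which every other chosen vertex forbids at most
`D` elements. -/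
theorem exists_greedy_embedding {ι V : Type*} [Fintype ι] [DecidableEq ι] [DecidableEq V]
    {R : ι → ι → Prop} (hR : ∀ i j, R i j → R j i) (G : SimpleGraph V) (T₀ : Finset ι)
    (g₀ : ι → V) (A : ι → Finset V) {D : ℝ}
    (hinj₀ : ∀ i ∈ T₀, ∀ j ∈ T₀, i ≠ j → g₀ i ≠ g₀ j)
    (hadj₀ : ∀ i ∈ T₀, ∀ j ∈ T₀, R i j → G.Adj (g₀ i) (g₀ j))
    (hA₀ : ∀ i ∉ T₀, ∀ w ∈ A i, ∀ j ∈ T₀, w ≠ g₀ j ∧ (R i j → G.Adj w (g₀ j)))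
    (hA : ∀ i ∉ T₀, ∀ j ∉ T₀, i ≠ j → ∀ v ∈ A j, ∃ B : Finset V, (B.card : ℝ) ≤ D ∧
      ∀ w ∈ A i, w ∉ B → w ≠ v ∧ (R i j → G.Adj w v))
    (hcard : ∀ i ∉ T₀, Fintype.card ι * D < (A i).card) (hD : 0 ≤ D) (hirr : ∀ i, ¬ R i i) :
    ∃ g : ι → V, Function.Injective g ∧ (∀ i j, R i j → G.Adj (g i) (g j)) ∧
      ∀ i ∈ T₀, g i = g₀ i := by
  classical
  suffices h : ∀ T : Finset ι, Disjoint T T₀ → ∃ g : ι → V,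
      (∀ i ∈ T ∪ T₀, ∀ j ∈ T ∪ T₀, i ≠ j → g i ≠ g j ∧ (R i j → G.Adj (g i) (g j))) ∧
      (∀ i ∈ T₀, g i = g₀ i) ∧ ∀ i ∈ T, g i ∈ A i by
    obtain ⟨g, hg, hg₀, -⟩ := h T₀ᶜ disjoint_compl_left
    have hmem (i : ι) : i ∈ T₀ᶜ ∪ T₀ := by
      simp only [Finset.mem_union, Finset.mem_compl]; tauto
    refine ⟨g, fun i j hij => ?_, fun i j hij => ?_, hg₀⟩
    · by_contra hne
      exact (hg i (hmem i) j (hmem j) hne).1 hij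
    · refine (hg i (hmem i) j (hmem j) ?_).2 hij
      rintro rfl
      exact hirr i hij
  intro T
  induction T using Finset.induction_on with
  | empty =>
    intro _
    refine ⟨g₀, fun i hi j hj hij => ?_, fun _ _ => rfl, by simp⟩
    rw [Finset.empty_union] at hi hj
    exact ⟨hinj₀ i hi j hj hij, hadj₀ i hi j hj⟩
  | insert k T hkT ih =>
    intro hdis
    rw [Finset.disjoint_insert_left] at hdis
    obtain ⟨hk, hdis⟩ := hdis
    obtain ⟨g, hg, hg₀, hgA⟩ := ih hdis
    have hT₀ (j : ι) (hj : j ∈ T) : j ∉ T₀ := Finset.disjoint_left.1 hdis hj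
    have hB : ∀ j : ι, ∃ B : Finset V, (B.card : ℝ) ≤ D ∧
        (j ∈ T → ∀ w ∈ A k, w ∉ B → w ≠ g j ∧ (R k j → G.Adj w (g j))) := by
      intro j
      by_cases hj : j ∈ T
      · obtain ⟨B, hB, hB'⟩ := hA k hk j (hT₀ j hj) (fun h => hkT (h ▸ hj)) (g j) (hgA j hj)
        exact ⟨B, hB, fun _ => hB'⟩
      · exact ⟨∅, by simpa using hD, fun h => absurd h hj⟩
    choose B hBcard hB using hB
    have hlt : ((Finset.univ.biUnion B).card : ℝ) < (A k).card := by
      refine lt_of_le_of_lt ?_ (hcard k hk)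
      calc ((Finset.univ.biUnion B).card : ℝ) ≤ ∑ j, ((B j).card : ℝ) := by
            exact_mod_cast Finset.card_biUnion_le
        _ ≤ ∑ _j : ι, D := Finset.sum_le_sum fun j _ => hBcard j
        _ = Fintype.card ι * D := by simp
    obtain ⟨w, hwA, hwB⟩ : ∃ w ∈ A k, w ∉ Finset.univ.biUnion B := by
      by_contra! hcon
      exact absurd (Finset.card_le_card hcon) (not_le.2 (by exact_mod_cast hlt))
    have hwB' (j : ι) : w ∉ B j := fun h =>
      hwB (Finset.mem_biUnion.2 ⟨j, Finset.mem_univ _, h⟩)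
    have hw (j : ι) (hj : j ∈ T ∪ T₀) : w ≠ g j ∧ (R k j → G.Adj w (g j)) := by
      rcases Finset.mem_union.1 hj with hj | hj
      · exact hB j hj w hwA (hwB' j)
      · rw [hg₀ j hj]
        exact hA₀ k hk w hwA j hj
    have hkU : k ∉ T ∪ T₀ := by simp [hkT, hk]
    have hne (j : ι) (hj : j ∈ T ∪ T₀) : j ≠ k := fun h => hkU (h ▸ hj)
    refine ⟨Function.update g k w, ?_, ?_, ?_⟩
    · intro i hi j hj hij
      rw [Finset.insert_union, Finset.mem_insert] at hi hj
      rcases hi with rfl | hi <;> rcases hj with rfl | hj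
      · exact absurd rfl hij
      · rw [Function.update_self, Function.update_of_ne (hne j hj)]
        exact hw j hj
      · rw [Function.update_self, Function.update_of_ne (hne i hi)]
        exact ⟨(hw i hi).1.symm, fun h => ((hw i hi).2 (hR _ _ h)).symm⟩
      · rw [Function.update_of_ne (hne i hi), Function.update_of_ne (hne j hj)]
        exact hg i hi j hj hij
    · intro i hi
      rw [Function.update_of_ne (hne i (Finset.mem_union_right _ hi))]
      exact hg₀ i hi
    · intro i hi
      rcases Finset.mem_insert.1 hi with rfl | hi
      · rw [Function.update_self]; exact hwA
      · rw [Function.update_of_ne (hne i (Finset.mem_union_left _ hi))]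
        exact hgA i hi

theorem contains_of_turan_star {W V : Type*} {F : SimpleGraph W} {r a m : ℕ} (hr : 0 < r)
    (hm : r * (a + 2) ≤ m) (hm0 : 0 < m) (hex : exNum m F = eCnt (turanGraph m r) + a)
    {G : SimpleGraph V} {g : Fin m → V} (hg : Function.Injective g)
    (hT : ∀ i j : Fin m, (i : ℕ) % r ≠ j % r → G.Adj (g i) (g j))
    (hstar : ∀ j : Fin m, j ≠ ⟨0, hm0⟩ → G.Adj (g ⟨0, hm0⟩) (g j)) : Contains F G := by
  have hlt (k : Fin (a + 1)) : r * ((k : ℕ) + 1) < m :=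
    lt_of_lt_of_le (Nat.mul_lt_mul_of_pos_left (by omega) hr) hm
  let f : Fin (a + 1) → Sym2 (Fin m) := fun k => s(⟨0, hm0⟩, ⟨r * ((k : ℕ) + 1), hlt k⟩)
  have hf : Function.Injective f := by
    intro k l hkl
    have h := Sym2.congr_right.1 hkl
    rw [Fin.mk.injEq] at h
    have := Nat.eq_of_mul_eq_mul_left hr h
    ext
    omega
  refine contains_of_turan_embedding hex hg hT (Finset.univ.image f) ?_ ?_ ?_
  · rw [Finset.card_image_of_injective _ hf]
    simp
  · intro e he
    obtain ⟨k, -, rfl⟩ := Finset.mem_image.1 he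
    simp [f, turanGraph]
  · intro e he
    obtain ⟨k, -, rfl⟩ := Finset.mem_image.1 he
    refine hstar _ ?_
    rw [Ne, Fin.mk.injEq]
    have := Nat.mul_pos hr (Nat.succ_pos (k : ℕ))
    exact this.ne'

theorem finite_card_le_of_exNum {W : Type*} {F : SimpleGraph W} {r a m : ℕ} (hr : 0 < r)
    (hm : r * (a + 2) ≤ m) (hm0 : 0 < m) (hex : exNum m F = eCnt (turanGraph m r) + a) :
    Finite W ∧ Nat.card W ≤ m := by
  have h : Contains F (⊤ : SimpleGraph (Fin m)) := by
    refine contains_of_turan_star hr hm hm0 hex (g := id) Function.injective_id ?_ ?_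
    · rintro i j hij
      exact fun h => hij (by rw [show i = j from h])
    · exact fun j hj => hj.symm
  obtain ⟨f, hf⟩ := h
  refine ⟨Finite.of_injective f hf, ?_⟩
  simpa using Nat.card_le_card_of_injective f hf

/-- A vertex whose neighbourhood is large in every part, inside the set of vertices which are
joined to almost all other parts, is contained in a copy of `F`. -/
theorem contains_of_large_neighborhoods {W : Type*} {F : SimpleGraph W} {r a m n : ℕ}
    (hr : 0 < r) (hm : r * (a + 2) ≤ m) (hm0 : 0 < m)
    (hex : exNum m F = eCnt (turanGraph m r) + a) {G : SimpleGraph (Fin n)}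
    {p : Fin n → Fin r} {v : Fin n} (C : Fin r → Finset (Fin n)) {D : ℝ} (hD : 0 ≤ D)
    (hCp : ∀ j, ∀ w ∈ C j, p w = j) (hCadj : ∀ j, ∀ w ∈ C j, G.Adj v w)
    (hCmiss : ∀ j, ∀ w ∈ C j, ((missing G p w).card : ℝ) ≤ D)
    (hC : ∀ j, m * (D + 1) < (C j).card) : Contains F G := by
  classical
  let c : Fin m → Fin r := fun i => ⟨i % r, Nat.mod_lt _ hr⟩
  have hc (i j : Fin m) : c i ≠ c j ↔ (i : ℕ) % r ≠ j % r := by simp [c]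
  let z : Fin m := ⟨0, hm0⟩
  obtain ⟨g, hg, hadj, hgz⟩ := exists_greedy_embedding
    (R := fun i j : Fin m => i ≠ j ∧ (c i ≠ c j ∨ i = z ∨ j = z))
    (fun i j h => ⟨h.1.symm, by
      rcases h.2 with h | h | h
      exacts [Or.inl h.symm, Or.inr (Or.inr h), Or.inr (Or.inl h)]⟩)
    G {z} (fun _ => v) (fun i => C (c i)) (D := D + 1)
    (fun i hi j hj hij => by simp_all)
    (fun i hi j hj hij => by simp_all)
    (fun i _ w hw j _ => ⟨(hCadj _ w hw).ne', fun _ => (hCadj _ w hw).symm⟩)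
    (fun i hi j hj _ x hx => by
      refine ⟨insert x (missing G p x), ?_, fun w hw hwB => ?_⟩
      · calc ((insert x (missing G p x)).card : ℝ) ≤ ((missing G p x).card + 1 : ℕ) := by
              exact_mod_cast Finset.card_insert_le _ _
          _ ≤ D + 1 := by push_cast; linarith [hCmiss _ x hx]
      · rw [Finset.mem_insert, not_or, mem_missing, hCp _ w hw, hCp _ x hx] at hwB
        refine ⟨hwB.1, fun hR => ?_⟩
        have hij : c i ≠ c j := by
          rcases hR.2 with h | h | h
          · exact h
          · exact absurd (Finset.mem_singleton.2 h) hi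
          · exact absurd (Finset.mem_singleton.2 h) hj
        by_contra hna
        exact hwB.2 ⟨hij.symm, fun h => hna h.symm⟩)
    (fun i _ => by rw [Fintype.card_fin]; exact hC (c i)) (by linarith)
    (fun i h => h.1 rfl)
  refine contains_of_turan_star hr hm hm0 hex hg (fun i j hij => hadj i j ?_)
    (fun j hj => hadj _ j ⟨hj.symm, Or.inr (Or.inl rfl)⟩)
  exact ⟨fun h => hij (by rw [h]), Or.inl ((hc i j).2 hij)⟩

/-- If every vertex is joined to almost all other parts, then more than `a` edges inside one part
force a copy of `F`. -/
theorem contains_of_lt_inCnt {W : Type*} {F : SimpleGraph W} {r a m n : ℕ}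
    (hr : 0 < r) (hm : r * (2 * a + 2) ≤ m) (hm0 : 0 < m)
    (hex : exNum m F = eCnt (turanGraph m r) + a) {G : SimpleGraph (Fin n)}
    {p : Fin n → Fin r} {D : ℝ} (hD : 0 ≤ D)
    (hmiss : ∀ w, ((missing G p w).card : ℝ) ≤ D)
    (hsize : ∀ j, (m + (2 * a + 2)) * (D + 1) < partSize p j) {i : Fin r}
    (hi : a < inCnt G p i) : Contains F G := by
  classical
  let c : Fin m → Fin r := fun i => ⟨i % r, Nat.mod_lt _ hr⟩
  obtain ⟨E, hEsub, hEcard⟩ := Set.exists_subset_card_eq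
    (s := {e : Sym2 (Fin n) | e ∈ G.edgeSet ∧ Sym2.map p e = Sym2.diag i}) (n := a + 1) hi
  lift E to Finset (Sym2 (Fin n)) using Set.toFinite E
  rw [Set.ncard_coe_finset] at hEcard
  let S : Finset (Fin n) := E.biUnion Sym2.toFinset
  have hScard : S.card ≤ 2 * a + 2 := by
    calc S.card ≤ ∑ e ∈ E, e.toFinset.card := Finset.card_biUnion_le
      _ ≤ ∑ _e ∈ E, 2 := Finset.sum_le_sum fun e _ => by
          induction e with
          | h x y => rw [Sym2.toFinset_mk_eq]; exact Finset.card_le_two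
      _ = 2 * a + 2 := by rw [Finset.sum_const, hEcard, smul_eq_mul]; ring
  have hES (x y : Fin n) (h : s(x, y) ∈ E) : x ∈ S ∧ y ∈ S :=
    ⟨Finset.mem_biUnion.2 ⟨_, h, by simp⟩, Finset.mem_biUnion.2 ⟨_, h, by simp⟩⟩
  have hSp (x : Fin n) (hx : x ∈ S) : p x = i := by
    obtain ⟨e, he, hxe⟩ := Finset.mem_biUnion.1 hx
    have := (hEsub he).2
    induction e with
    | h u w =>
      rw [Sym2.map_mk, Sym2.diag, Sym2.eq_iff] at this
      simp only [Sym2.mem_toFinset, Sym2.mem_iff] at hxe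
      rcases hxe with rfl | rfl <;> tauto
  let h : Fin n → Fin m := fun x => if hx : x ∈ S then
    ⟨i + r * (S.equivFin ⟨x, hx⟩ : ℕ), by
      have h1 := (S.equivFin ⟨x, hx⟩).2
      have h2 : r * ((S.equivFin ⟨x, hx⟩ : ℕ) + 1) ≤ r * (2 * a + 2) :=
        Nat.mul_le_mul_left _ (by omega)
      have h3 := i.2
      rw [Nat.mul_add] at h2
      omega⟩ else ⟨0, hm0⟩
  have hh (x : Fin n) (hx : x ∈ S) : (h x : ℕ) = i + r * (S.equivFin ⟨x, hx⟩ : ℕ) := by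
    simp only [h, dif_pos hx]
  have hhmod (x : Fin n) (hx : x ∈ S) : (h x : ℕ) % r = i := by
    rw [hh x hx, Nat.add_mul_mod_self_left, Nat.mod_eq_of_lt i.2]
  have hhinj : Set.InjOn h S := by
    intro x hx y hy hxy
    have h1 : (h x : ℕ) = h y := by rw [hxy]
    rw [hh x hx, hh y hy] at h1
    have h2 := Nat.eq_of_mul_eq_mul_left hr (Nat.add_left_cancel h1)
    have h3 := S.equivFin.injective (Fin.ext h2)
    exact congrArg Subtype.val h3
  have hne : Nonempty (Fin n) := by
    obtain ⟨e, he⟩ := Finset.card_pos.1 (by omega : 0 < E.card)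
    induction e with
    | h x y => exact ⟨x⟩
  let g₀ := Function.invFunOn h (S : Set (Fin n))
  have hg₀ (x : Fin n) (hx : x ∈ S) : g₀ (h x) = x := hhinj.leftInvOn_invFunOn hx
  have hcS (x : Fin n) (hx : x ∈ S) : c (h x) = i := Fin.ext (hhmod x hx)
  let N : Finset (Fin n) := S ∪ S.biUnion (missing G p)
  have hN : (N.card : ℝ) ≤ (2 * a + 2) * (D + 1) := by
    have h1 : (N.card : ℝ) ≤ S.card + (S.biUnion (missing G p)).card := by
      exact_mod_cast Finset.card_union_le _ _
    have h2 : ((S.biUnion (missing G p)).card : ℝ) ≤ S.card * D := by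
      calc ((S.biUnion (missing G p)).card : ℝ) ≤ ∑ x ∈ S, ((missing G p x).card : ℝ) := by
            exact_mod_cast Finset.card_biUnion_le
        _ ≤ ∑ _x ∈ S, D := Finset.sum_le_sum fun x _ => hmiss x
        _ = S.card * D := by simp
    have h3 : (S.card : ℝ) ≤ 2 * a + 2 := by exact_mod_cast hScard
    nlinarith
  obtain ⟨g, hg, hadj, hgS⟩ := exists_greedy_embedding
    (R := fun i j : Fin m => c i ≠ c j) (fun i j h => h.symm) G (S.image h) g₀
    (fun k => (Finset.univ.filter fun w => p w = c k) \ N) (D := D + 1)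
    (fun k hk l hl hkl => by
      obtain ⟨x, hx, rfl⟩ := Finset.mem_image.1 hk
      obtain ⟨y, hy, rfl⟩ := Finset.mem_image.1 hl
      rw [hg₀ x hx, hg₀ y hy]
      exact fun hxy => hkl (by rw [hxy]))
    (fun k hk l hl hkl => by
      obtain ⟨x, hx, rfl⟩ := Finset.mem_image.1 hk
      obtain ⟨y, hy, rfl⟩ := Finset.mem_image.1 hl
      exact absurd ((hcS x hx).trans (hcS y hy).symm) hkl)
    (fun k _ w hw l hl => by
      obtain ⟨x, hx, rfl⟩ := Finset.mem_image.1 hl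
      rw [Finset.mem_sdiff, Finset.mem_filter, Finset.mem_union, not_or] at hw
      obtain ⟨⟨-, hwk⟩, hwS, hwm⟩ := hw
      rw [hg₀ x hx, hcS x hx]
      refine ⟨fun hwx => hwS (hwx ▸ hx), fun hki => ?_⟩
      by_contra hna
      refine hwm (Finset.mem_biUnion.2 ⟨x, hx, mem_missing.2 ⟨?_, fun h => hna h.symm⟩⟩)
      rw [hSp x hx, hwk]
      exact hki.symm)
    (fun k _ l _ _ x hx => by
      refine ⟨insert x (missing G p x), ?_, fun w hw hwB => ?_⟩
      · calc ((insert x (missing G p x)).card : ℝ) ≤ ((missing G p x).card + 1 : ℕ) := by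
              exact_mod_cast Finset.card_insert_le _ _
          _ ≤ D + 1 := by push_cast; linarith [hmiss x]
      · rw [Finset.mem_sdiff, Finset.mem_filter] at hw hx
        rw [Finset.mem_insert, not_or, mem_missing, hw.1.2, hx.1.2] at hwB
        refine ⟨hwB.1, fun hR => ?_⟩
        by_contra hna
        exact hwB.2 ⟨hR.symm, fun h => hna h.symm⟩)
    (fun k _ => by
      have h1 : ((Finset.univ.filter fun w => p w = c k).card : ℝ) ≤
          ((Finset.univ.filter fun w => p w = c k) \ N).card + N.card := by
        exact_mod_cast Finset.card_le_card_sdiff_add_card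
      have h2 := hsize (c k)
      rw [partSize_eq_card] at h2
      rw [Fintype.card_fin]
      linarith) (by linarith) (fun k h => h rfl)
  have hgh (x : Fin n) (hx : x ∈ S) : g (h x) = x := by
    rw [hgS _ (Finset.mem_image_of_mem h hx), hg₀ x hx]
  have hinv (e : Sym2 (Fin n)) (he : e ∈ E) : Sym2.map g (Sym2.map h e) = e := by
    induction e with
    | h x y =>
      obtain ⟨hx, hy⟩ := hES x y he
      rw [Sym2.map_mk, Sym2.map_mk, hgh x hx, hgh y hy]
  refine contains_of_turan_embedding hex hg (fun k l hkl => hadj k l ?_)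
    (E.image (Sym2.map h)) ?_ ?_ ?_
  · simpa [c] using hkl
  · rw [Finset.card_image_of_injOn fun e he e' he' hee => ?_, hEcard]
    · omega
    · rw [← hinv e he, ← hinv e' he', hee]
  · intro e he
    obtain ⟨e, heE, rfl⟩ := Finset.mem_image.1 he
    induction e with
    | h x y =>
      obtain ⟨hx, hy⟩ := hES x y heE
      rw [Sym2.map_mk]
      simp [turanGraph, hhmod x hx, hhmod y hy]
  · intro e he
    obtain ⟨e, heE, rfl⟩ := Finset.mem_image.1 he
    rw [hinv e heE]
    exact (hEsub heE).1

/-! ### Replacing the neighbourhood of a vertex -/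

/-- The graph obtained from `G` by making `Q \ {u}` the neighbourhood of `u`. -/
def replaceNbhd {V : Type*} (G : SimpleGraph V) (u : V) (Q : Finset V) : SimpleGraph V where
  Adj x y := x ≠ y ∧ ((x ≠ u ∧ y ≠ u ∧ G.Adj x y) ∨ (x = u ∧ y ∈ Q) ∨ (y = u ∧ x ∈ Q))
  symm := ⟨fun x y h => ⟨h.1.symm, by
    rcases h.2 with h | h | h
    exacts [Or.inl ⟨h.2.1, h.1, h.2.2.symm⟩, Or.inr (Or.inr h), Or.inr (Or.inl h)]⟩⟩
  loopless := ⟨fun _ h => h.1 rfl⟩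

theorem replaceNbhd_adj_self {V : Type*} {G : SimpleGraph V} {u y : V} {Q : Finset V}
    (hu : u ∉ Q) : (replaceNbhd G u Q).Adj u y ↔ y ∈ Q := by
  constructor
  · rintro ⟨hne, h | h | h⟩
    · exact absurd rfl h.1
    · exact h.2
    · exact absurd h.1.symm hne
  · intro h
    exact ⟨fun huy => hu (huy ▸ h), Or.inr (Or.inl ⟨rfl, h⟩)⟩

theorem replaceNbhd_adj_of_ne {V : Type*} {G : SimpleGraph V} {u x y : V} {Q : Finset V}
    (hx : x ≠ u) (hy : y ≠ u) : (replaceNbhd G u Q).Adj x y ↔ G.Adj x y := by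
  constructor
  · rintro ⟨-, h | h | h⟩
    · exact h.2.2
    · exact absurd h.1 hx
    · exact absurd h.1 hy
  · intro h
    exact ⟨h.ne, Or.inl ⟨hx, hy, h⟩⟩

/-- If every small subset of the new neighbourhood has a common neighbour in `G`, then replacing
the neighbourhood of `u` creates no copy of `F`. -/
theorem fFree_replaceNbhd {W V : Type*} [Finite W] [DecidableEq V] {F : SimpleGraph W}
    {G : SimpleGraph V} (hG : FFree F G) {u : V} {Q : Finset V} (hu : u ∉ Q)
    (hQ : ∀ S : Finset V, S.card ≤ Nat.card W → ∃ z ∉ S, ∀ w ∈ S, w ∈ Q → G.Adj z w) :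
    FFree F (replaceNbhd G u Q) := by
  classical
  have := Fintype.ofFinite W
  rintro ⟨f, hf⟩
  by_cases hr : ∃ w₀, f w₀ = u
  · obtain ⟨w₀, hw₀⟩ := hr
    obtain ⟨z, hzS, hz⟩ := hQ (Finset.univ.image f)
      (by rw [Nat.card_eq_fintype_card]; exact Finset.card_image_le)
    have hzf (w : W) : z ≠ f w := fun h =>
      hzS (h ▸ Finset.mem_image_of_mem f (Finset.mem_univ w))
    have hfu (w : W) (hw : w ≠ w₀) : f w ≠ u := fun h => hw (hf (h.trans hw₀.symm))
    have hadj (w : W) (hw : F.Adj w₀ w) : G.Adj z (f w) := by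
      refine hz _ (Finset.mem_image_of_mem f (Finset.mem_univ w)) ?_
      have h1 := f.map_adj hw
      rwa [hw₀, replaceNbhd_adj_self hu] at h1
    refine hG ⟨⟨Function.update f w₀ z, fun {a b} hab => ?_⟩, fun a b hab => ?_⟩
    · by_cases ha : a = w₀
      · subst ha
        rw [Function.update_self, Function.update_of_ne hab.ne']
        exact hadj b hab
      · by_cases hb : b = w₀
        · subst hb
          rw [Function.update_self, Function.update_of_ne ha]
          exact (hadj a hab.symm).symm
        · rw [Function.update_of_ne ha, Function.update_of_ne hb]
          exact (replaceNbhd_adj_of_ne (hfu a ha) (hfu b hb)).1 (f.map_adj hab)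
    · change Function.update f w₀ z a = Function.update f w₀ z b at hab
      by_cases ha : a = w₀ <;> by_cases hb : b = w₀
      · rw [ha, hb]
      · subst ha
        rw [Function.update_self, Function.update_of_ne hb] at hab
        exact absurd hab (hzf b)
      · subst hb
        rw [Function.update_self, Function.update_of_ne ha] at hab
        exact absurd hab.symm (hzf a)
      · rw [Function.update_of_ne ha, Function.update_of_ne hb] at hab
        exact hf hab
  · push Not at hr
    exact hG ⟨⟨f, fun {a b} hab => (replaceNbhd_adj_of_ne (hr a) (hr b)).1 (f.map_adj hab)⟩, hf⟩

/-- In a spectral extremal graph, no admissible replacement of a neighbourhood carries more weight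
of the leading eigenvector. -/
theorem sum_le_of_specExtremal {W : Type*} {F : SimpleGraph W} {n : ℕ} {G : SimpleGraph (Fin n)}
    (hG : SpecExtremal F G) {y : Fin n → ℝ} (hy0 : ∀ u, 0 ≤ y u)
    (hy : ∀ u, ∑ v, adjMat G u v * y v = specRad G * y u) {u : Fin n} {Q : Finset (Fin n)}
    (hu : u ∉ Q) (hQ : FFree F (replaceNbhd G u Q)) :
    ∑ w ∈ Q, y w ≤ ∑ w, adjMat G u w * y w := by
  classical
  by_contra! hlt
  set G' := replaceNbhd G u Q with hG'
  have hle := hG.2 G' hQ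
  have hrow : ∑ w, adjMat G' u w * y w = ∑ w ∈ Q, y w := by
    rw [← Finset.sum_subset (Finset.subset_univ Q) fun w _ hw => ?_]
    · refine Finset.sum_congr rfl fun w hw => ?_
      rw [adjMat_apply, if_pos ((replaceNbhd_adj_self hu).2 hw), one_mul]
    · rw [adjMat_apply, if_neg fun h => hw ((replaceNbhd_adj_self hu).1 h), zero_mul]
  have hsplit (H : SimpleGraph (Fin n)) : ∑ a, ∑ b, adjMat H a b * (y a * y b) =
      2 * (y u * ∑ w, adjMat H u w * y w) + ∑ a ∈ Finset.univ.erase u,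
        ∑ b ∈ Finset.univ.erase u, adjMat H a b * (y a * y b) := by
    rw [sum_sum_eq_two_mul_add (v := u) (by simp [adjMat_apply])
      fun a b => by rw [adjMat_symm H a b, mul_comm (y a)], Finset.mul_sum (a := y u)]
    congr 2
    exact Finset.sum_congr rfl fun w _ => by ring
  have hrest : ∑ a ∈ Finset.univ.erase u, ∑ b ∈ Finset.univ.erase u,
      adjMat G' a b * (y a * y b) = ∑ a ∈ Finset.univ.erase u, ∑ b ∈ Finset.univ.erase u,
      adjMat G a b * (y a * y b) := by
    refine Finset.sum_congr rfl fun a ha => Finset.sum_congr rfl fun b hb => ?_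
    have := replaceNbhd_adj_of_ne (G := G) (Q := Q) (Finset.ne_of_mem_erase ha)
      (Finset.ne_of_mem_erase hb)
    rw [adjMat_apply, adjMat_apply]
    simp only [hG', this]
  have h1 := hsplit G
  have h2 := hsplit G'
  rw [hrest, hrow] at h2
  rw [quadForm_of_eigenvector G hy] at h1
  have h3 := mul_le_mul_of_nonneg_left hlt.le (hy0 u)
  have h4 : 0 ≤ ∑ a, y a ^ 2 := Finset.sum_nonneg fun a _ => sq_nonneg _
  have h5 := mul_le_mul_of_nonneg_right hle h4
  have h6 := eigenvector_of_quadForm_ge G' y (by linarith) u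
  rw [hrow] at h6
  rw [hy u] at hlt
  have h7 := mul_le_mul_of_nonneg_right hle (hy0 u)
  linarith

/-! ### The structure of the extremal graph -/

theorem card_missing_eq {n r : ℕ} (G : SimpleGraph (Fin n)) (p : Fin n → Fin r) (v : Fin n) :
    ((missing G p v).card : ℝ) =
      (n - partSize p (p v)) - (deg G v - degIn G p (p v) v) := by
  have h1 := sum_missing G p v fun _ => 1
  have h2 : (n : ℝ) = ∑ _w : Fin n, (1 : ℝ) := by simp
  have h3 : (partSize p (p v) : ℝ) = ∑ w, if p w = p v then (1 : ℝ) else 0 := by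
    rw [partSize_eq_card, Finset.card_filter]
    push_cast
    rfl
  rw [Finset.sum_const, nsmul_eq_mul, mul_one] at h1
  rw [h1, deg_eq_sum, degIn_eq_sum, h3]
  nth_rewrite 1 [h2]
  rw [← Finset.sum_sub_distrib, ← Finset.sum_sub_distrib, ← Finset.sum_sub_distrib]
  refine Finset.sum_congr rfl fun w _ => ?_
  by_cases h : p v = p w
  · simp [h]
  · simp [h, Ne.symm h]

/-- The vertices which miss more than `D` vertices of the other parts. -/
noncomputable def badVertices {n r : ℕ} (G : SimpleGraph (Fin n)) (p : Fin n → Fin r) (D : ℝ) :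
    Finset (Fin n) :=
  Finset.univ.filter fun v => D < ((missing G p v).card : ℝ)

theorem card_missing_le_of_notMem {n r : ℕ} {G : SimpleGraph (Fin n)} {p : Fin n → Fin r} {D : ℝ}
    {v : Fin n} (hv : v ∉ badVertices G p D) : ((missing G p v).card : ℝ) ≤ D := by
  simpa [badVertices] using hv

theorem card_badVertices_mul_le {n r : ℕ} (G : SimpleGraph (Fin n)) (p : Fin n → Fin r) (D : ℝ) :
    (badVertices G p D).card * D ≤ ∑ v, ((missing G p v).card : ℝ) := by
  calc ((badVertices G p D).card : ℝ) * D = ∑ _v ∈ badVertices G p D, D := by simp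
    _ ≤ ∑ v ∈ badVertices G p D, ((missing G p v).card : ℝ) :=
        Finset.sum_le_sum fun v hv => (Finset.mem_filter.1 hv).2.le
    _ ≤ _ := Finset.sum_le_sum_of_subset_of_nonneg (Finset.subset_univ _)
        fun v _ _ => Nat.cast_nonneg _

/-- In a spectral extremal graph every vertex has almost as many neighbours as there are vertices
outside its part. -/
theorem le_deg_of_specExtremal {W : Type*} [Finite W] {F : SimpleGraph W} {n r m : ℕ}
    (hW : Nat.card W ≤ m) {G : SimpleGraph (Fin n)} (hG : SpecExtremal F G)
    {p : Fin n → Fin r} {y : Fin n → ℝ} (hy0 : ∀ u, 0 ≤ y u)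
    (hy : ∀ u, ∑ v, adjMat G u v * y v = specRad G * y u) {D : ℝ} (hD : 0 ≤ D) (u : Fin n)
    (hsize : m * (D + 1) < partSize p (p u)) :
    (n : ℝ) - partSize p (p u) - (badVertices G p D).card - 2 * ∑ w, |y w - 1| ≤ deg G u := by
  classical
  let Q : Finset (Fin n) := (Finset.univ.filter fun w => ¬ p w = p u) \ badVertices G p D
  have huQ : u ∉ Q := by simp [Q]
  have hfree : FFree F (replaceNbhd G u Q) := by
    refine fFree_replaceNbhd hG.1 huQ fun S hS => ?_
    let B : Finset (Fin n) := S ∪ (S ∩ Q).biUnion (missing G p)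
    have hSm : (S.card : ℝ) ≤ m := by exact_mod_cast hS.trans hW
    have hB : (B.card : ℝ) ≤ m * (D + 1) := by
      have h1 : (B.card : ℝ) ≤ S.card + ((S ∩ Q).biUnion (missing G p)).card := by
        exact_mod_cast Finset.card_union_le _ _
      have h2 : (((S ∩ Q).biUnion (missing G p)).card : ℝ) ≤ S.card * D := by
        calc (((S ∩ Q).biUnion (missing G p)).card : ℝ)
            ≤ ∑ x ∈ S ∩ Q, ((missing G p x).card : ℝ) := by
              exact_mod_cast Finset.card_biUnion_le
          _ ≤ ∑ _x ∈ S ∩ Q, D := Finset.sum_le_sum fun x hx => card_missing_le_of_notMem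
              (Finset.mem_sdiff.1 (Finset.mem_inter.1 hx).2).2
          _ = (S ∩ Q).card * D := by simp
          _ ≤ S.card * D := by
              gcongr
              exact Finset.inter_subset_left
      nlinarith
    obtain ⟨z, hz, hzB⟩ : ∃ z ∈ Finset.univ.filter (fun w => p w = p u), z ∉ B := by
      by_contra! hcon
      have h1 := Finset.card_le_card hcon
      rw [← partSize_eq_card] at h1
      have h2 : (partSize p (p u) : ℝ) ≤ B.card := by exact_mod_cast h1
      linarith
    rw [Finset.mem_filter] at hz
    rw [Finset.mem_union, not_or] at hzB
    refine ⟨z, hzB.1, fun w hwS hwQ => ?_⟩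
    by_contra hna
    refine hzB.2 (Finset.mem_biUnion.2 ⟨w, Finset.mem_inter.2 ⟨hwS, hwQ⟩, mem_missing.2 ⟨?_, ?_⟩⟩)
    · rw [hz.2]
      exact (Finset.mem_filter.1 (Finset.mem_sdiff.1 hwQ).1).2
    · exact fun h => hna h.symm
  have hsum := sum_le_of_specExtremal hG hy0 hy huQ hfree
  have h1 : (Q.card : ℝ) - ∑ w, |y w - 1| ≤ ∑ w ∈ Q, y w := by
    have h2 : ∑ w ∈ Q, |y w - 1| ≤ ∑ w, |y w - 1| :=
      Finset.sum_le_sum_of_subset_of_nonneg (Finset.subset_univ _) fun w _ _ => abs_nonneg _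
    have h3 : ∑ w ∈ Q, (1 - |y w - 1|) ≤ ∑ w ∈ Q, y w :=
      Finset.sum_le_sum fun w _ => by linarith [neg_abs_le (y w - 1)]
    rw [Finset.sum_sub_distrib, Finset.sum_const, nsmul_eq_mul, mul_one] at h3
    linarith
  have h2 : ∑ w, adjMat G u w * y w ≤ deg G u + ∑ w, |y w - 1| := by
    rw [deg_eq_sum, ← Finset.sum_add_distrib]
    refine Finset.sum_le_sum fun w _ => ?_
    nlinarith [le_abs_self (y w - 1), abs_nonneg (y w - 1), adjMat_nonneg G u w,
      adjMat_le_one G u w]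
  have h3 : (n : ℝ) - partSize p (p u) - (badVertices G p D).card ≤ Q.card := by
    have h4 : ((Finset.univ.filter fun w => ¬ p w = p u).card : ℝ) ≤
        Q.card + (badVertices G p D).card := by
      exact_mod_cast Finset.card_le_card_sdiff_add_card
    have h5 : (partSize p (p u) : ℝ) + (Finset.univ.filter fun w => ¬ p w = p u).card = n := by
      rw [partSize_eq_card]
      exact_mod_cast (Finset.card_filter_add_card_filter_not _).trans (by simp)
    linarith
  linarith

/-- In an `F`-free graph with a maximum cut, no vertex has many neighbours in its own part. -/
theorem degIn_self_le_of_fFree {W : Type*} {F : SimpleGraph W} {r a m n : ℕ} (hr : 0 < r)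
    (hm : r * (a + 2) ≤ m) (hm0 : 0 < m) (hex : exNum m F = eCnt (turanGraph m r) + a)
    {G : SimpleGraph (Fin n)} (hG : FFree F G) {p : Fin n → Fin r}
    (hp : ∀ q : Fin n → Fin r, crossCnt G q ≤ crossCnt G p) {D : ℝ} (hD : 0 ≤ D) (v : Fin n) :
    (degIn G p (p v) v : ℝ) ≤ m * (D + 1) + (badVertices G p D).card := by
  classical
  by_contra! hlt
  refine hG (contains_of_large_neighborhoods hr hm hm0 hex (p := p) (v := v)
    (fun j => (Finset.univ.filter fun w => G.Adj v w ∧ p w = j) \ badVertices G p D) hD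
    (fun j w hw => ?_) (fun j w hw => ?_) (fun j w hw => ?_) fun j => ?_)
  · exact (Finset.mem_filter.1 (Finset.mem_sdiff.1 hw).1).2.2
  · exact (Finset.mem_filter.1 (Finset.mem_sdiff.1 hw).1).2.1
  · exact card_missing_le_of_notMem (Finset.mem_sdiff.1 hw).2
  · have h1 : ((Finset.univ.filter fun w => G.Adj v w ∧ p w = j).card : ℝ) ≤
        ((Finset.univ.filter fun w => G.Adj v w ∧ p w = j) \ badVertices G p D).card +
          (badVertices G p D).card := by
      exact_mod_cast Finset.card_le_card_sdiff_add_card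
    have h2 : degIn G p j v = (Finset.univ.filter fun w => G.Adj v w ∧ p w = j).card := by
      rw [degIn, Nat.card_eq_fintype_card, Fintype.card_subtype]
    have h3 : (degIn G p (p v) v : ℝ) ≤ degIn G p j v := by
      exact_mod_cast degIn_le_of_crossCnt_max hp v j
    rw [← h2] at h1
    linarith

/-- Few vertices miss many crossing edges. -/
theorem card_badVertices_le {n r : ℕ} {G : SimpleGraph (Fin n)} {p : Fin n → Fin r}
    {D θ η m : ℝ} (hn : (0 : ℝ) < n) (hm : 1 ≤ m) (hη : 0 < η) (hηθ : η < θ)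
    (hθm : 1368 * m * θ < 1) (hmD : m * D = θ * n / 2)
    (hmis : ∑ v, ((missing G p v).card : ℝ) ≤ 684 * η ^ 3 * n ^ 2) :
    ((badVertices G p D).card : ℝ) ≤ η * n := by
  have hθ : 0 < θ := hη.trans hηθ
  have hD : 0 ≤ D := by
    refine le_of_mul_le_mul_left ?_ (by linarith : 0 < m)
    rw [hmD, mul_zero]
    positivity
  by_contra! hlt
  have h1 := (card_badVertices_mul_le G p D).trans hmis
  have h2 : η * n * (θ * n / 2) ≤ m * (684 * η ^ 3 * n ^ 2) := by
    calc η * n * (θ * n / 2) = m * (η * n * D) := by rw [← hmD]; ring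
      _ ≤ m * ((badVertices G p D).card * D) := by gcongr
      _ ≤ m * (684 * η ^ 3 * n ^ 2) := by gcongr
  have h3 : θ * (η * n ^ 2) ≤ (1368 * m * η ^ 2) * (η * n ^ 2) := by linarith
  have h4 : θ ≤ 1368 * m * η ^ 2 := le_of_mul_le_mul_right h3 (by positivity)
  have h5 : 1368 * m * η ^ 2 ≤ 1368 * m * θ * θ := by
    rw [mul_assoc _ θ θ, ← sq]
    gcongr
  have h6 : 1368 * m * θ * θ < 1 * θ := by gcongr
  linarith

/-- The bounds on `θ` which are used, in terms of the order `m` of the forbidden configuration. -/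
theorem theta_bounds {r m ℓ θ : ℝ} (hr : 2 ≤ r) (hm : 1 ≤ m) (hℓ : m ≤ ℓ) (hθ : 0 < θ)
    (hθℓ : θ < 1 / (100 * r ^ 5 * ℓ)) :
    3200 * m * θ < 1 ∧ 100 * m * r * θ < 1 / r := by
  have hmθ : 0 < m * θ := by positivity
  have hθm : 100 * r ^ 5 * m * θ < 1 := by
    have h1 : 0 < 100 * r ^ 5 * ℓ := by
      have : 0 < ℓ := by linarith
      positivity
    rw [lt_div_iff₀ h1] at hθℓ
    calc 100 * r ^ 5 * m * θ ≤ 100 * r ^ 5 * ℓ * θ := by gcongr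
      _ < 1 := by linarith
  constructor
  · have h1 : (2 : ℝ) ^ 5 ≤ r ^ 5 := by gcongr
    nlinarith
  · have h1 : r ^ 2 ≤ r ^ 5 := pow_le_pow_right₀ (by linarith) (by norm_num)
    rw [lt_div_iff₀ (by linarith)]
    nlinarith

theorem stmt_11 {W : Type*} (r a : ℕ) (hr : 2 ≤ r) (F : SimpleGraph W) (h : HypStar r a F) :
    ∃ ℓ₀ : ℕ, ∀ ℓ ≥ ℓ₀, ∀ θ ε : ℝ, 0 < θ → 0 < ε →
      θ < 1 / (100 * r ^ 5 * ℓ) → 2 * ε < θ ^ 3 →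
      ∃ n₀ : ℕ, ∀ n ≥ n₀, ∀ G : SimpleGraph (Fin n), SpecExtremal F G →
        ∀ p : Fin n → Fin r, GoodPartition r G ε p →
          Lset r G ε = ∅ ∧ ∀ i : Fin r, inCnt G p i ≤ a := by
  obtain ⟨m₀, hm₀⟩ := h
  obtain ⟨m, hmdef⟩ : ∃ m, m = r * (m₀ + 2 * a + 2) := ⟨_, rfl⟩
  have hr0 : 0 < r := by omega
  have hm2 : r * (2 * a + 2) ≤ m := hmdef ▸ Nat.mul_le_mul_left _ (by omega)
  have hm1 : r * (a + 2) ≤ m := hmdef ▸ Nat.mul_le_mul_left _ (by omega)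
  have hmm₀ : m₀ + 2 * a + 2 ≤ m := hmdef ▸ Nat.le_mul_of_pos_left _ hr0
  have hm0 : 0 < m := by omega
  have hex := (hm₀ m (by omega)).1
  obtain ⟨hfin, hcardW⟩ := finite_card_le_of_exNum hr0 hm1 hm0 hex
  refine ⟨m, fun ℓ hℓ θ ε hθ hε hθℓ hεθ => ?_⟩
  obtain ⟨η, hη⟩ : ∃ η, η = ε ^ ((1 : ℝ) / 3) := ⟨_, rfl⟩
  obtain ⟨q, hq⟩ : ∃ q, q = Real.sqrt ε := ⟨_, rfl⟩
  obtain ⟨ρ, hρ⟩ : ∃ ρ, ρ = 1 / (r : ℝ) := ⟨_, rfl⟩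
  have hr' : (2 : ℝ) ≤ r := by exact_mod_cast hr
  have hm' : (1 : ℝ) ≤ m := by exact_mod_cast hm0
  have hη0 : 0 < η := hη ▸ Real.rpow_pos_of_pos hε _
  have hη3 : η ^ 3 = ε := by
    rw [hη, ← Real.rpow_natCast, ← Real.rpow_mul hε.le]
    norm_num
  have hq0 : 0 < q := hq ▸ Real.sqrt_pos.2 hε
  have hq2 : q ^ 2 = ε := hq ▸ Real.sq_sqrt hε.le
  have hρ0 : 0 < ρ := hρ ▸ by positivity
  have hηθ : η < θ := lt_of_pow_lt_pow_left₀ 3 hθ.le (by rw [hη3]; linarith)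
  obtain ⟨hθm', hθρ⟩ := theta_bounds hr' hm' (by exact_mod_cast hℓ) hθ hθℓ
  rw [← hρ] at hθρ
  have hqη : 21 * q ≤ η := by
    refine (abs_le_of_sq_le_sq' ?_ hη0.le).2
    have h1 : 441 * η ≤ 1 := by nlinarith
    calc (21 * q) ^ 2 = 441 * η * η ^ 2 := by rw [mul_pow, hq2, ← hη3]; ring
      _ ≤ 1 * η ^ 2 := by gcongr
      _ = η ^ 2 := one_mul _
  refine ⟨max (max 6 m₀) (max ⌈1 / ε⌉₊ ⌈4 * m / θ⌉₊), fun n hn G hG p hp => ?_⟩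
  simp only [max_le_iff] at hn
  obtain ⟨⟨hn6, hnm₀⟩, hnε, hnθ⟩ := hn
  have hn' : (6 : ℝ) ≤ n := by exact_mod_cast hn6
  have hεn : 1 ≤ ε * n := by
    have h1 := Nat.ceil_le.1 hnε
    rw [div_le_iff₀ hε] at h1
    linarith
  have hθn : 4 * m ≤ θ * n := by
    have h1 := Nat.ceil_le.1 hnθ
    rw [div_le_iff₀ hθ] at h1
    linarith
  obtain ⟨hcut, hin, hsize⟩ := hp
  simp only [← hq, ← hρ] at hsize
  have hlam : (1 - 1 / (r : ℝ)) * n - 1 ≤ specRad G :=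
    (specRad_turanGraph_ge (by omega)).trans
      (hG.2 _ (turanGraph_fFree hr (by omega) (hm₀ n hnm₀).1 (hm₀ n hnm₀).2))
  obtain ⟨y, hy0, hyn, hy⟩ := exists_nonneg_eigenvector (by omega) G
  obtain ⟨hdev, hmis⟩ := stability_of_specRad_ge hr hn6 hεn hlam hin hy0 hyn hy
  have habs : ∑ w, |y w - 1| ≤ 9 * q * n := by
    refine abs_le_of_sq_le_sq' ?_ (by positivity) |>.2
    have h1 := sq_sum_le_card_mul_sum_sq (s := (Finset.univ : Finset (Fin n)))
      (f := fun w => |y w - 1|)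
    simp only [sq_abs, Finset.card_univ, Fintype.card_fin] at h1
    calc _ ≤ _ := h1
      _ ≤ n * (76 * ε * n) := by gcongr
      _ ≤ (9 * q * n) ^ 2 := by rw [← hq2]; nlinarith [sq_nonneg (q * n)]
  obtain ⟨D, hDdef⟩ : ∃ D, D = θ / (2 * m) * n := ⟨_, rfl⟩
  have hD0 : 0 ≤ D := hDdef ▸ by positivity
  have hmD : m * D = θ * n / 2 := by rw [hDdef]; field_simp
  have hbad := card_badVertices_le (by linarith) hm' hη0 hηθ (by linarith) hmD
    (hη3.symm ▸ hmis)
  have hmDθ : m * (D + 1) ≤ 3 / 4 * (θ * n) := by linarith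
  have hηn : η * n ≤ θ * n := by gcongr
  have hqn : 21 * (q * n) ≤ η * n := by rw [← mul_assoc]; gcongr
  have hηn0 : 0 < η * n := by positivity
  have hmrn : 100 * (m * r * θ * n) ≤ ρ * n := by
    calc 100 * (m * r * θ * n) = (100 * m * r * θ) * n := by ring
      _ ≤ ρ * n := by gcongr
  have hrη : 2 * (η * n) ≤ r * (η * n) := by gcongr
  have hrθ : 2 * (θ * n) ≤ r * (θ * n) := by gcongr
  have hmrθ : r * (θ * n) ≤ m * r * θ * n := by
    have : 0 ≤ r * (θ * n) := by positivity
    nlinarith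
  have hdeg (u : Fin n) : (1 - ρ) * n - 3 * (r * (η * n)) < deg G u := by
    have h1 := le_deg_of_specExtremal hcardW hG hy0 hy hD0 u (by linarith [(hsize (p u)).1])
    linarith [(hsize (p u)).2]
  have hmiss (v : Fin n) : ((missing G p v).card : ℝ) ≤ 5 * (r * (θ * n)) := by
    have h1 := degIn_self_le_of_fFree hr0 hm1 hm0 hex hG.1 hcut hD0 v
    have h2 : r * (η * n) ≤ r * (θ * n) := by gcongr
    rw [card_missing_eq]
    linarith [(hsize (p v)).1, hdeg v]
  constructor
  · refine Set.eq_empty_iff_forall_notMem.2 fun u hu => ?_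
    have h1 : (deg G u : ℝ) ≤ (1 - 1 / (r : ℝ) - 3 * r * ε ^ ((1 : ℝ) / 3)) * n := hu
    rw [← hη, ← hρ] at h1
    linarith [hdeg u]
  · intro i
    by_contra! hi
    refine hG.1 (contains_of_lt_inCnt hr0 hm2 hm0 hex (by positivity) hmiss (fun j => ?_) hi)
    have h1 : (m : ℝ) + (2 * a + 2) ≤ 2 * m := by
      have : (m₀ + 2 * a + 2 : ℝ) ≤ m := by exact_mod_cast hmm₀
      have h2 : (0 : ℝ) ≤ m₀ := Nat.cast_nonneg _
      linarith
    calc ((m : ℝ) + (2 * a + 2)) * (5 * (r * (θ * n)) + 1)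
        ≤ 2 * m * (5 * (r * (θ * n)) + 1) := by gcongr
      _ < partSize p j := by linarith [(hsize j).1]
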